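/- Let (V, {f_{il}}) be a weak lower perfect space over k, and let B and B' be two lower perfect bases of V, with structure maps 𝐟_{il}, 𝐞_{il} on B and 𝐟'_{il}, 𝐞'_{il} on B'. Assume p_H(B_H) = p_H(B'_H). Then there exists a bijection ψ : B → B' such that: (1) ψ(B ∩ V_μ) = B' ∩ V_μ for all μ ∈ P; (2) d_{il}(ψ(b)) = d_{il}(b) for all b ∈ B and (i,l) ∈ I^∞; (3) extending ψ by ψ(0) = 0, one has ψ(𝐟_{il}(b)) = 𝐟'_{il}(ψ(b)) and ψ(𝐞_{il}(b)) = 𝐞'_{il}(ψ(b)) for all b ∈ B and (i,l) ∈ I^∞; (4) p_H(ψ(b)) = p_H(b) for all b ∈ B_H; and (5) for every b ∈ B and every good index sequence i, d(i,b) = d(i,ψ(b)), and for all sufficiently large k the elements b_k ∈ B_H and ψ(b)_k ∈ B'_H (formed in B and B' respectively) satisfy p_H(b_k) = p_H(ψ(b)_k) ∈ p_H(B_H). -/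

import Mathlib

open Function

/-- A weak lower perfect space: a `P`-graded `k`-vector space `V = ⊕_{μ ∈ P} V_μ`
with endomorphisms `f il` for `(i,l) ∈ I^∞ = I × ℤ_{>0}`. -/
structure WeakLowerPerfectSpace (k I P V : Type*) [Field k] [AddCommGroup P]
    [AddCommGroup V] [Module k V] where
  /-- the simple roots `α_i` -/
  alpha : I → P
  alpha_indep : LinearIndependent ℤ alpha
  /-- `P` is a free abelian group -/
  free : Module.Free ℤ P
  /-- the weight spaces `V_μ` -/
  weight : P → Submodule k V
  weight_indep : iSupIndep weight
  weight_sup : ⨆ μ : P, weight μ = ⊤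
  /-- the endomorphisms `f_{il}` -/
  f : I × ℕ+ → Module.End k V
  finiteDim : ∀ μ : P, Module.Finite k (weight μ)
  support_bounded : ∃ s : Finset P, ∀ μ : P, weight μ ≠ ⊥ →
    ∃ lam ∈ s, lam - μ ∈ AddSubmonoid.closure (Set.range alpha)
  f_weight : ∀ (i : I) (l : ℕ+) (μ : P),
    (weight μ).map (f (i, l)) ≤ weight (μ - (l : ℕ) • alpha i)

namespace WeakLowerPerfectSpace

variable {k I P V : Type*} [Field k] [AddCommGroup P] [AddCommGroup V] [Module k V]

/-- `d il v` is the unique `n` with `v ∈ f_{il}^n V \ f_{il}^{n+1} V` (for `v ≠ 0`),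
realized as the largest `n` with `v ∈ f_{il}^n V`. -/
noncomputable def d (S : WeakLowerPerfectSpace k I P V) (il : I × ℕ+) (v : V) : ℕ :=
  sSup {n : ℕ | v ∈ LinearMap.range (S.f il ^ n)}

end WeakLowerPerfectSpace

/-- A lower perfect basis `B` of a weak lower perfect space, with structure maps
`F il : B → B ∪ {0}` (extended by `F il 0 = 0`). -/
structure LowerPerfectBasis {k I P V : Type*} [Field k] [AddCommGroup P]
    [AddCommGroup V] [Module k V] (S : WeakLowerPerfectSpace k I P V) (B : Set V) where
  indep : LinearIndependent k (fun b : B => (b : V))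
  spans : Submodule.span k B = ⊤
  graded : ∀ b ∈ B, ∃ μ : P, b ∈ S.weight μ
  /-- the structure map `𝐟_{il}` -/
  F : I × ℕ+ → V → V
  F_zero : ∀ il : I × ℕ+, F il 0 = 0
  F_mem : ∀ il : I × ℕ+, ∀ b ∈ B, F il b ∈ B ∪ {0}
  F_approx : ∀ il : I × ℕ+, ∀ b ∈ B, ∃ c : kˣ,
    S.f il b - (c : k) • F il b ∈ LinearMap.range (S.f il ^ (S.d il b + 2))
  F_inj : ∀ b ∈ B, ∀ b' ∈ B, (∀ il : I × ℕ+, F il b = F il b') → b = b'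

namespace WeakLowerPerfectSpace

variable {k I P V : Type*} [Field k] [AddCommGroup P] [AddCommGroup V] [Module k V]

/-- The subspace `Σ_{(i,l) ∈ I^∞} f_{il} V`. -/
noncomputable def rad (S : WeakLowerPerfectSpace k I P V) : Submodule k V :=
  ⨆ il : I × ℕ+, LinearMap.range (S.f il)

/-- The highest core `B_H = {b ∈ B | d_{il}(b) = 0 for all (i,l) ∈ I^∞}`. -/
def highestCore (S : WeakLowerPerfectSpace k I P V) (B : Set V) : Set V :=
  {b | b ∈ B ∧ ∀ il : I × ℕ+, S.d il b = 0}

end WeakLowerPerfectSpace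

/-- Iterated application `𝐟_{i_1 l_1}^{a_1} ⋯ 𝐟_{i_r l_r}^{a_r}(b)` (rightmost factor applied
first): `fComp F seq a r b = F_{seq 0}^{a 0} (⋯ (F_{seq (r-1)}^{a (r-1)} b))`. -/
def fComp {V ι : Type*} (F : ι → V → V) (seq : ℕ → ι) (a : ℕ → ℕ) : ℕ → V → V
  | 0, v => v
  | m + 1, v => fComp F seq a m ((F (seq m))^[a m] v)

/-- Iterated application `𝐞_{i_r l_r}^{a_r} ⋯ 𝐞_{i_1 l_1}^{a_1}(b)` (leftmost index applied
first): `eComp E seq a r b = E_{seq (r-1)}^{a (r-1)} (⋯ (E_{seq 0}^{a 0} b))`. -/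
def eComp {V ι : Type*} (E : ι → V → V) (seq : ℕ → ι) (a : ℕ → ℕ) : ℕ → V → V
  | 0, v => v
  | m + 1, v => (E (seq m))^[a m] (eComp E seq a m v)

/-- The sequence `b_0 = b`, `b_{k+1} = 𝐞_{i_{k+1} l_{k+1}}^{d_{i_{k+1} l_{k+1}}(b_k)}(b_k)`. -/
def bseq {V ι : Type*} (E : ι → V → V) (d : ι → V → ℕ) (seq : ℕ → ι) (b : V) : ℕ → V
  | 0 => b
  | m + 1 => (E (seq m))^[d (seq m) (bseq E d seq b m)] (bseq E d seq b m)

/-- The lexicographic strict order on sequences of non-negative integers. -/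
def SeqLt (a a' : ℕ → ℕ) : Prop :=
  ∃ m : ℕ, (∀ s < m, a s = a' s) ∧ a m < a' m

/-- The lexicographic order on sequences of non-negative integers. -/
def SeqLe (a a' : ℕ → ℕ) : Prop := a = a' ∨ SeqLt a a'

namespace WeakLowerPerfectSpace

variable {k I P V : Type*} [Field k] [AddCommGroup P] [AddCommGroup V] [Module k V]

/-- The composite `f_{i_1 l_1}^{a_1} ⋯ f_{i_m l_m}^{a_m}` (as an endomorphism, the
rightmost factor acting first). -/
noncomputable def pprod (S : WeakLowerPerfectSpace k I P V) (seq : ℕ → I × ℕ+)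
    (a : ℕ → ℕ) (m : ℕ) : Module.End k V :=
  ((List.range m).map fun j => S.f (seq j) ^ a j).prod

/-- The subspace `V^{>i,a} = Σ_{k=1}^r f_{i_1l_1}^{a_1}⋯f_{i_{k−1}l_{k−1}}^{a_{k−1}} f_{i_kl_k}^{a_k+1} V`. -/
noncomputable def Vgt (S : WeakLowerPerfectSpace k I P V) (seq : ℕ → I × ℕ+)
    (a : ℕ → ℕ) (r : ℕ) : Submodule k V :=
  ⨆ m : Fin r, LinearMap.range (S.pprod seq a (m : ℕ) * S.f (seq (m : ℕ)) ^ (a (m : ℕ) + 1))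

/-- The subspace `V^{≥i,a} = V^{>i,a} + f_{i_1l_1}^{a_1}⋯f_{i_rl_r}^{a_r} V`. -/
noncomputable def Vge (S : WeakLowerPerfectSpace k I P V) (seq : ℕ → I × ℕ+)
    (a : ℕ → ℕ) (r : ℕ) : Submodule k V :=
  S.Vgt seq a r ⊔ LinearMap.range (S.pprod seq a r)

end WeakLowerPerfectSpace

namespace WeakLowerPerfectSpace

variable {k I P V : Type*} [Field k] [AddCommGroup P] [AddCommGroup V] [Module k V]
  (S : WeakLowerPerfectSpace k I P V)

/-- A height function on weights which grows along the operators `f_{il}`. -/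
theorem exists_height : ∃ ht : P → ℕ, ∀ (p : I × ℕ+) (μ : P), S.weight μ ≠ ⊥ →
    ht μ < ht (μ - (p.2 : ℕ) • S.alpha p.1) := by
  classical
  have hN : LinearIndependent ℕ S.alpha := by
    refine LinearIndependent.restrict_scalars (K := ℤ) (fun a b h => ?_) S.alpha_indep
    simpa using h
  let g : P → ℕ := fun x =>
    if h : ∃ c : I →₀ ℕ, Finsupp.linearCombination ℕ S.alpha c = x then h.choose.degree else 0
  have hg : ∀ c : I →₀ ℕ, g (Finsupp.linearCombination ℕ S.alpha c) = c.degree := by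
    intro c
    have h : ∃ c' : I →₀ ℕ, Finsupp.linearCombination ℕ S.alpha c' =
      Finsupp.linearCombination ℕ S.alpha c := ⟨c, rfl⟩
    simp only [g, dif_pos h]
    rw [hN h.choose_spec]
  have hcl : ∀ x, x ∈ AddSubmonoid.closure (Set.range S.alpha) →
      ∃ c : I →₀ ℕ, Finsupp.linearCombination ℕ S.alpha c = x := by
    intro x hx
    rw [← Submodule.span_nat_eq_addSubmonoidClosure] at hx
    exact Finsupp.mem_span_range_iff_exists_finsupp.1 hx
  have hstep : ∀ x, x ∈ AddSubmonoid.closure (Set.range S.alpha) → ∀ p : I × ℕ+,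
      g (x + (p.2 : ℕ) • S.alpha p.1) = g x + p.2 := by
    intro x hx p
    obtain ⟨c, rfl⟩ := hcl x hx
    have : Finsupp.linearCombination ℕ S.alpha c + (p.2 : ℕ) • S.alpha p.1 =
        Finsupp.linearCombination ℕ S.alpha (c + Finsupp.single p.1 (p.2 : ℕ)) := by
      simp
    rw [this, hg, hg]
    simp
  obtain ⟨s, hs⟩ := S.support_bounded
  refine ⟨fun μ => ∑ lam ∈ s,
    if lam - μ ∈ AddSubmonoid.closure (Set.range S.alpha) then g (lam - μ) else 0, ?_⟩
  intro p μ hμ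
  have hmem : ∀ x, x ∈ AddSubmonoid.closure (Set.range S.alpha) →
      x + (p.2 : ℕ) • S.alpha p.1 ∈ AddSubmonoid.closure (Set.range S.alpha) := fun x hx =>
    add_mem hx (nsmul_mem (AddSubmonoid.subset_closure (Set.mem_range_self _)) _)
  have hsub : ∀ lam, lam - (μ - (p.2 : ℕ) • S.alpha p.1) =
      (lam - μ) + (p.2 : ℕ) • S.alpha p.1 := fun lam => by abel
  apply Finset.sum_lt_sum
  · intro lam _
    by_cases h : lam - μ ∈ AddSubmonoid.closure (Set.range S.alpha)
    · rw [if_pos h, hsub, if_pos (hmem _ h), hstep _ h]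
      omega
    · rw [if_neg h]
      exact Nat.zero_le _
  · obtain ⟨lam, hl, h⟩ := hs μ hμ
    refine ⟨lam, hl, ?_⟩
    rw [if_pos h, hsub, if_pos (hmem _ h), hstep _ h]
    have := p.2.pos
    omega

/-- The projections onto the weight spaces. -/
theorem exists_proj : ∃ π : P → V →ₗ[k] V,
    (∀ μ, ∀ v ∈ S.weight μ, π μ v = v) ∧
    (∀ μ ν, μ ≠ ν → ∀ v ∈ S.weight ν, π μ v = 0) := by
  classical
  have hI : DirectSum.IsInternal S.weight :=
    DirectSum.isInternal_submodule_of_iSupIndep_of_iSup_eq_top S.weight_indep S.weight_sup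
  let := hI.chooseDecomposition
  refine ⟨fun μ => (S.weight μ).subtype ∘ₗ DirectSum.component k P (fun i => S.weight i) μ ∘ₗ
    (DirectSum.decomposeLinearEquiv S.weight).toLinearMap, ?_, ?_⟩
  · intro μ v hv
    exact DirectSum.decompose_of_mem_same S.weight hv
  · intro μ ν h v hv
    exact DirectSum.decompose_of_mem_ne S.weight hv h.symm

theorem f_pow_weight (p : I × ℕ+) (n : ℕ) {μ : P} {v : V} (hv : v ∈ S.weight μ) :
    (S.f p ^ n) v ∈ S.weight (μ - n • ((p.2 : ℕ) • S.alpha p.1)) := by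
  induction n with
  | zero => simpa using hv
  | succ n ih =>
    rw [pow_succ', Module.End.mul_apply, succ_nsmul, ← sub_sub]
    exact S.f_weight p.1 p.2 _ (Submodule.mem_map_of_mem ih)

theorem le_height {ht : P → ℕ} (hht : ∀ (p : I × ℕ+) (μ : P), S.weight μ ≠ ⊥ →
    ht μ < ht (μ - (p.2 : ℕ) • S.alpha p.1)) (p : I × ℕ+) (n : ℕ) {μ : P} {v : V}
    (hv : v ∈ S.weight μ) (h0 : (S.f p ^ n) v ≠ 0) :
    n ≤ ht (μ - n • ((p.2 : ℕ) • S.alpha p.1)) := by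
  induction n with
  | zero => exact Nat.zero_le _
  | succ n ih =>
    rw [pow_succ', Module.End.mul_apply] at h0
    have h1 : (S.f p ^ n) v ≠ 0 := fun h => h0 (by rw [h, map_zero])
    have h2 := hht p _ (fun h => h1 ((Submodule.mem_bot k).1 (h ▸ S.f_pow_weight p n hv)))
    rw [succ_nsmul, ← sub_sub]
    exact lt_of_le_of_lt (ih h1) h2

/-- Large powers of `f_{il}` do not meet a given weight space. -/
theorem exists_proj_range_eq_zero {π : P → V →ₗ[k] V}
    (hπ : ∀ μ ν, μ ≠ ν → ∀ v ∈ S.weight ν, π μ v = 0)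
    (p : I × ℕ+) (μ : P) :
    ∃ N : ℕ, ∀ n ≥ N, ∀ v ∈ LinearMap.range (S.f p ^ n), π μ v = 0 := by
  obtain ⟨ht, hht⟩ := S.exists_height
  refine ⟨ht μ + 1, ?_⟩
  rintro n hn _ ⟨u, rfl⟩
  have hu : u ∈ ⨆ ν, S.weight ν := S.weight_sup ▸ Submodule.mem_top
  induction hu using Submodule.iSup_induction' with
  | mem ν u hu =>
    by_cases h : μ = ν - n • ((p.2 : ℕ) • S.alpha p.1)
    · by_contra h0
      have h1 : (S.f p ^ n) u ≠ 0 := fun h => h0 (by rw [h, map_zero])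
      have := S.le_height hht p n hu h1
      rw [← h] at this
      omega
    · exact hπ _ _ h _ (S.f_pow_weight p n hu)
  | zero => simp
  | add x y _ _ hx hy => simp [hx, hy]

theorem range_pow_anti (p : I × ℕ+) {m n : ℕ} (h : m ≤ n) :
    LinearMap.range (S.f p ^ n) ≤ LinearMap.range (S.f p ^ m) := by
  rintro _ ⟨u, rfl⟩
  exact ⟨(S.f p ^ (n - m)) u, by
    rw [← Module.End.mul_apply, ← pow_add, Nat.add_sub_cancel' h]⟩

theorem f_pow_mem_range (p : I × ℕ+) {m n : ℕ} {v : V} (h : v ∈ LinearMap.range (S.f p ^ n)) :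
    (S.f p ^ m) v ∈ LinearMap.range (S.f p ^ (m + n)) := by
  obtain ⟨u, rfl⟩ := h
  exact ⟨u, by rw [pow_add, Module.End.mul_apply]⟩

theorem mem_range_pow_iff (p : I × ℕ+) {μ : P} {v : V} (hv : v ∈ S.weight μ) (h0 : v ≠ 0)
    (n : ℕ) : v ∈ LinearMap.range (S.f p ^ n) ↔ n ≤ S.d p v := by
  obtain ⟨π, h1, h2⟩ := S.exists_proj
  obtain ⟨N, hN⟩ := S.exists_proj_range_eq_zero h2 p μ
  have hb : BddAbove {n : ℕ | v ∈ LinearMap.range (S.f p ^ n)} := by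
    refine ⟨N, fun n hn => ?_⟩
    by_contra! h
    exact h0 (by rw [← h1 μ v hv]; exact hN n h.le v hn)
  constructor
  · intro h
    exact le_csSup hb h
  · intro h
    have hne : {n : ℕ | v ∈ LinearMap.range (S.f p ^ n)}.Nonempty := ⟨0, v, by simp⟩
    exact S.range_pow_anti p h (Nat.sSup_mem hne hb)

end WeakLowerPerfectSpace

namespace LowerPerfectBasis

variable {k I P V : Type*} [Field k] [AddCommGroup P] [AddCommGroup V] [Module k V]
  {S : WeakLowerPerfectSpace k I P V} {B : Set V} (LB : LowerPerfectBasis S B)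

include LB in
theorem ne_zero {b : V} (hb : b ∈ B) : b ≠ 0 := LB.indep.ne_zero ⟨b, hb⟩

include LB in
theorem zero_notMem : (0 : V) ∉ B := fun h => LB.ne_zero h rfl

include LB in
theorem mem_of_mem_span {X : Set V} (hX : X ⊆ B) {b : V} (hb : b ∈ B)
    (h : b ∈ Submodule.span k X) : b ∈ X := by
  by_contra hn
  refine LB.indep.notMem_span_image (s := {x : B | (x : V) ∈ X}) (x := ⟨b, hb⟩) hn ?_
  have : (fun x : B => (x : V)) '' {x : B | (x : V) ∈ X} = X := by
    ext v
    constructor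
    · rintro ⟨x, hx, rfl⟩
      exact hx
    · intro hv
      exact ⟨⟨v, hX hv⟩, hv, rfl⟩
  rw [this]
  exact h

include LB in
theorem proj_mem_span {π : P → V →ₗ[k] V} (h1 : ∀ μ, ∀ v ∈ S.weight μ, π μ v = v)
    (h2 : ∀ μ ν, μ ≠ ν → ∀ v ∈ S.weight ν, π μ v = 0) {X : Set V} (hX : X ⊆ B) (μ : P) {y : V}
    (hy : y ∈ Submodule.span k X) : π μ y ∈ Submodule.span k X := by
  induction hy using Submodule.span_induction with
  | mem x hx =>
    obtain ⟨ν, hν⟩ := LB.graded x (hX hx)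
    by_cases h : μ = ν
    · rw [h, h1 ν x hν]
      exact Submodule.subset_span hx
    · rw [h2 μ ν h x hν]
      exact zero_mem _
  | zero => simp
  | add x y _ _ hx hy => rw [map_add]; exact add_mem hx hy
  | smul a x _ hx => rw [map_smul]; exact Submodule.smul_mem _ _ hx

include LB in
theorem mem_range_pow_iff (p : I × ℕ+) {b : V} (hb : b ∈ B) (n : ℕ) :
    b ∈ LinearMap.range (S.f p ^ n) ↔ n ≤ S.d p b := by
  obtain ⟨μ, hμ⟩ := LB.graded b hb
  exact S.mem_range_pow_iff p hμ (LB.ne_zero hb) n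

theorem iterate_F_zero (p : I × ℕ+) (n : ℕ) : (LB.F p)^[n] 0 = 0 :=
  Function.iterate_fixed (LB.F_zero p) n

theorem d_lt_d_F (p : I × ℕ+) {b : V} (hb : b ∈ B) (hF : LB.F p b ∈ B) :
    S.d p b + 1 ≤ S.d p (LB.F p b) := by
  rw [← LB.mem_range_pow_iff p hF]
  obtain ⟨c, hc⟩ := LB.F_approx p b hb
  have h1 : S.f p b ∈ LinearMap.range (S.f p ^ (S.d p b + 1)) := by
    have := S.f_pow_mem_range p (m := 1) ((LB.mem_range_pow_iff p hb _).2 le_rfl)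
    rwa [pow_one, add_comm] at this
  have h2 := sub_mem h1 (S.range_pow_anti p (Nat.le_succ _) hc)
  rw [sub_sub_cancel] at h2
  exact (Submodule.smul_mem_iff _ c.ne_zero).1 h2

theorem iterate_F_mem (p : I × ℕ+) {b : V} (hb : b ∈ B) (n : ℕ) :
    (LB.F p)^[n] b ∈ B ∨ (LB.F p)^[n] b = 0 := by
  induction n with
  | zero => exact Or.inl hb
  | succ n ih =>
    rw [Function.iterate_succ_apply']
    rcases ih with h | h
    · exact LB.F_mem p _ h
    · rw [h, LB.F_zero]; exact Or.inr rfl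

theorem iterate_F_mem_of_succ (p : I × ℕ+) {b : V} (hb : b ∈ B) {n : ℕ}
    (h : (LB.F p)^[n + 1] b ∈ B) : (LB.F p)^[n] b ∈ B := by
  rcases LB.iterate_F_mem p hb n with h' | h'
  · exact h'
  · rw [Function.iterate_succ_apply', h', LB.F_zero] at h
    exact absurd h LB.zero_notMem

theorem le_d_iterate_F (p : I × ℕ+) {b : V} (hb : b ∈ B) (n : ℕ)
    (h : (LB.F p)^[n] b ∈ B) : S.d p b + n ≤ S.d p ((LB.F p)^[n] b) := by
  induction n with
  | zero => exact le_rfl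
  | succ n ih =>
    have h' := LB.iterate_F_mem_of_succ p hb h
    have h1 := ih h'
    rw [Function.iterate_succ_apply'] at h ⊢
    have h2 := LB.d_lt_d_F p h' h
    omega

theorem range_pow_le (p : I × ℕ+) (n : ℕ) : LinearMap.range (S.f p ^ n) ≤
    Submodule.span k {b | b ∈ B ∧ ∃ b₀ ∈ B, (LB.F p)^[n] b₀ = b} ⊔
      LinearMap.range (S.f p ^ (n + 1)) := by
  induction n with
  | zero =>
    intro v _
    refine Submodule.mem_sup_left ?_
    have : {b | b ∈ B ∧ ∃ b₀ ∈ B, (LB.F p)^[0] b₀ = b} = B := by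
      ext b
      simp
    rw [this, LB.spans]
    trivial
  | succ n ih =>
    rintro _ ⟨u, rfl⟩
    rw [pow_succ' _ n, Module.End.mul_apply]
    have h := ih (LinearMap.mem_range_self (S.f p ^ n) u)
    obtain ⟨y, hy, z, hz, hyz⟩ := Submodule.mem_sup.1 h
    rw [← hyz, map_add]
    refine add_mem ?_ (Submodule.mem_sup_right ?_)
    · clear hyz
      induction hy using Submodule.span_induction with
      | mem x hx =>
        obtain ⟨hx, b₀, hb₀, rfl⟩ := hx
        obtain ⟨c, hc⟩ := LB.F_approx p _ hx
        rw [← sub_add_cancel (S.f p _) ((c : k) • LB.F p ((LB.F p)^[n] b₀))]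
        refine add_mem (Submodule.mem_sup_right (S.range_pow_anti p ?_ hc))
          (Submodule.mem_sup_left (Submodule.smul_mem _ _ ?_))
        · have := LB.le_d_iterate_F p hb₀ n hx
          omega
        · rw [← Function.iterate_succ_apply' (LB.F p)]
          rcases LB.iterate_F_mem p hb₀ (n + 1) with h | h
          · exact Submodule.subset_span ⟨h, b₀, hb₀, rfl⟩
          · rw [h]
            exact zero_mem _
      | zero => simp
      | add x y _ _ hx hy => rw [map_add]; exact add_mem hx hy
      | smul a x _ hx => rw [map_smul]; exact Submodule.smul_mem _ _ hx
    · have := S.f_pow_mem_range p (m := 1) hz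
      rwa [pow_one, add_comm] at this

theorem range_pow_le_add (p : I × ℕ+) (n m : ℕ) : LinearMap.range (S.f p ^ n) ≤
    Submodule.span k {b | b ∈ B ∧ ∃ b₀ ∈ B, (LB.F p)^[n] b₀ = b} ⊔
      LinearMap.range (S.f p ^ (n + m)) := by
  induction m with
  | zero => exact le_sup_right
  | succ m ih =>
    refine ih.trans (sup_le le_sup_left ((LB.range_pow_le p (n + m)).trans
      (sup_le_sup_right (Submodule.span_mono ?_) _)))
    rintro b ⟨hb, b₀, hb₀, rfl⟩
    refine ⟨hb, (LB.F p)^[m] b₀, ?_, (Function.iterate_add_apply _ _ _ _).symm⟩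
    rcases LB.iterate_F_mem p hb₀ m with h | h
    · exact h
    · rw [Function.iterate_add_apply, h, LB.iterate_F_zero] at hb
      exact absurd hb LB.zero_notMem

theorem mem_span_of_mem_range_pow (p : I × ℕ+) (n : ℕ) {μ : P} {v : V} (hμ : v ∈ S.weight μ)
    (hv : v ∈ LinearMap.range (S.f p ^ n)) :
    v ∈ Submodule.span k {b | b ∈ B ∧ ∃ b₀ ∈ B, (LB.F p)^[n] b₀ = b} := by
  obtain ⟨π, h1, h2⟩ := S.exists_proj
  obtain ⟨N, hN⟩ := S.exists_proj_range_eq_zero h2 p μ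
  obtain ⟨y, hy, z, hz, hyz⟩ := Submodule.mem_sup.1 (LB.range_pow_le_add p n N hv)
  have h3 : π μ v = π μ y := by rw [← hyz, map_add, hN _ (by omega) z hz, add_zero]
  rw [← h1 μ v hμ, h3]
  exact LB.proj_mem_span h1 h2 (fun b hb => hb.1) μ hy

theorem exists_iterate_F (p : I × ℕ+) {b : V} (hb : b ∈ B) {n : ℕ} (hn : n ≤ S.d p b) :
    ∃ b₀ ∈ B, (LB.F p)^[n] b₀ = b := by
  obtain ⟨μ, hμ⟩ := LB.graded b hb
  exact (LB.mem_of_mem_span (fun b hb => hb.1) hb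
    (LB.mem_span_of_mem_range_pow p n hμ ((LB.mem_range_pow_iff p hb n).2 hn))).2

include LB in
/-- `f_{il}^n V` is spanned by the basis elements `b` with `d_{il}(b) ≥ n`. -/
theorem range_pow_eq_span (p : I × ℕ+) (n : ℕ) :
    LinearMap.range (S.f p ^ n) = Submodule.span k {b | b ∈ B ∧ n ≤ S.d p b} := by
  apply le_antisymm
  · rintro _ ⟨u, rfl⟩
    have hu : u ∈ ⨆ ν, S.weight ν := S.weight_sup ▸ Submodule.mem_top
    induction hu using Submodule.iSup_induction' with
    | mem ν u hu =>
      refine Submodule.span_mono ?_ (LB.mem_span_of_mem_range_pow p n (S.f_pow_weight p n hu)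
        (LinearMap.mem_range_self _ u))
      rintro b ⟨hb, b₀, hb₀, rfl⟩
      have := LB.le_d_iterate_F p hb₀ n hb
      exact ⟨hb, by omega⟩
    | zero => simp
    | add x y _ _ hx hy => rw [map_add]; exact add_mem hx hy
  · rw [Submodule.span_le]
    rintro b ⟨hb, h⟩
    exact (LB.mem_range_pow_iff p hb n).2 h

/-- The maps `E il` are the partial inverses `𝐞_{il}` of the structure maps `𝐟_{il}`. -/
structure IsRaising (E : I × ℕ+ → V → V) : Prop where
  apply_of_F_eq : ∀ p, ∀ b ∈ B, ∀ b' ∈ B, LB.F p b' = b → E p b = b'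
  apply_of_forall_ne : ∀ p, ∀ b ∈ B, (∀ b' ∈ B, LB.F p b' ≠ b) → E p b = 0

namespace IsRaising

variable {LB} {E : I × ℕ+ → V → V} (hE : LB.IsRaising E)
include hE

theorem E_F {p : I × ℕ+} {b : V} (hb : b ∈ B) (hF : LB.F p b ∈ B) : E p (LB.F p b) = b :=
  hE.apply_of_F_eq p _ hF b hb rfl

theorem d_F {p : I × ℕ+} {b : V} (hb : b ∈ B) (hF : LB.F p b ∈ B) :
    S.d p (LB.F p b) = S.d p b + 1 := by
  refine le_antisymm ?_ (LB.d_lt_d_F p hb hF)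
  by_contra! h
  obtain ⟨b₀, hb₀, hb₀'⟩ := LB.exists_iterate_F p hF (Nat.succ_le_of_lt h)
  have h1 : (LB.F p)^[S.d p b + 1] b₀ ∈ B :=
    LB.iterate_F_mem_of_succ p hb₀ (by rw [hb₀']; exact hF)
  have h2 : (LB.F p)^[S.d p b + 1] b₀ = b := by
    refine Eq.trans (hE.apply_of_F_eq p _ hF _ h1 ?_).symm (hE.E_F hb hF)
    rw [← Function.iterate_succ_apply' (LB.F p)]
    exact hb₀'
  have := LB.le_d_iterate_F p hb₀ _ h1
  rw [h2] at this
  omega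

theorem E_mem {p : I × ℕ+} {b : V} (hb : b ∈ B) (hd : S.d p b ≠ 0) :
    E p b ∈ B ∧ LB.F p (E p b) = b ∧ S.d p b = S.d p (E p b) + 1 := by
  obtain ⟨b₀, hb₀, hb₀'⟩ := LB.exists_iterate_F p hb (n := 1) (by omega)
  have h1 : LB.F p b₀ = b := hb₀'
  have h2 : E p b = b₀ := hE.apply_of_F_eq p b hb b₀ hb₀ h1
  rw [h2]
  refine ⟨hb₀, h1, ?_⟩
  rw [← h1]
  exact hE.d_F hb₀ (h1 ▸ hb)

theorem E_eq_zero {p : I × ℕ+} {b : V} (hb : b ∈ B) (hd : S.d p b = 0) : E p b = 0 := by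
  refine hE.apply_of_forall_ne p b hb fun b' hb' h => ?_
  have := LB.d_lt_d_F p hb' (h ▸ hb)
  rw [h] at this
  omega

theorem iterate_E {p : I × ℕ+} {n : ℕ} : ∀ {b : V}, b ∈ B → S.d p b = n →
    (E p)^[n] b ∈ B ∧ S.d p ((E p)^[n] b) = 0 ∧ (LB.F p)^[n] ((E p)^[n] b) = b := by
  induction n with
  | zero => exact fun hb h => ⟨hb, h, rfl⟩
  | succ n ih =>
    intro b hb h
    obtain ⟨h1, h2, h3⟩ := hE.E_mem hb (by omega : S.d p b ≠ 0)
    obtain ⟨h4, h5, h6⟩ := ih h1 (by omega)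
    refine ⟨h4, h5, ?_⟩
    rw [Function.iterate_succ_apply' (LB.F p), Function.iterate_succ_apply (E p), h6, h2]

theorem iterate_F {p : I × ℕ+} {b : V} (hb : b ∈ B) (h0 : S.d p b = 0) {n : ℕ}
    (h : (LB.F p)^[n] b ∈ B) :
    S.d p ((LB.F p)^[n] b) = n ∧ (E p)^[n] ((LB.F p)^[n] b) = b := by
  induction n with
  | zero => exact ⟨h0, rfl⟩
  | succ n ih =>
    have h1 := LB.iterate_F_mem_of_succ p hb h
    obtain ⟨h2, h3⟩ := ih h1
    rw [Function.iterate_succ_apply'] at h ⊢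
    rw [hE.d_F h1 h, Function.iterate_succ_apply, hE.E_F h1 h]
    exact ⟨by omega, h3⟩

theorem f_pow_approx {p : I × ℕ+} {b : V} (hb : b ∈ B) (h0 : S.d p b = 0) (n : ℕ) :
    ∃ c : k, c ≠ 0 ∧
      (S.f p ^ n) b - c • (LB.F p)^[n] b ∈ LinearMap.range (S.f p ^ (n + 1)) := by
  induction n with
  | zero => exact ⟨1, one_ne_zero, by simp⟩
  | succ n ih =>
    obtain ⟨c, hc, h⟩ := ih
    have h' := S.f_pow_mem_range p (m := 1) h
    rw [pow_one, map_sub, map_smul, add_comm 1] at h'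
    rw [pow_succ' _ n, Module.End.mul_apply, Function.iterate_succ_apply']
    rcases LB.iterate_F_mem p hb n with hn | hn
    · obtain ⟨c', hc'⟩ := LB.F_approx p _ hn
      rw [(hE.iterate_F hb h0 hn).1] at hc'
      refine ⟨c * c', mul_ne_zero hc c'.ne_zero, ?_⟩
      have := add_mem h' (Submodule.smul_mem _ c hc')
      rwa [smul_sub, sub_add_sub_cancel, smul_smul] at this
    · refine ⟨1, one_ne_zero, ?_⟩
      rw [hn, map_zero, smul_zero, sub_zero] at h'
      rwa [hn, LB.F_zero, smul_zero, sub_zero]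

theorem approx {p : I × ℕ+} {b : V} (hb : b ∈ B) :
    ∃ c : k, c ≠ 0 ∧ b - c • (S.f p ^ S.d p b) ((E p)^[S.d p b] b) ∈
      LinearMap.range (S.f p ^ (S.d p b + 1)) := by
  obtain ⟨h1, h2, h3⟩ := hE.iterate_E hb (rfl : S.d p b = _)
  obtain ⟨c, hc, h⟩ := hE.f_pow_approx h1 h2 (S.d p b)
  rw [h3] at h
  refine ⟨c⁻¹, inv_ne_zero hc, ?_⟩
  have := Submodule.smul_mem _ (-c⁻¹) h
  rwa [smul_sub, smul_smul, neg_mul, inv_mul_cancel₀ hc, neg_smul, neg_smul, one_smul,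
    sub_neg_eq_add, neg_add_eq_sub] at this

end IsRaising

end LowerPerfectBasis

namespace WeakLowerPerfectSpace

variable {k I P V : Type*} [Field k] [AddCommGroup P] [AddCommGroup V] [Module k V]
  (S : WeakLowerPerfectSpace k I P V)

/-- The lexicographic filtration attached to a finite word `(p_1,a_1),…,(p_r,a_r)`:
`Σ_j f_{p_1}^{a_1}⋯f_{p_j}^{a_j+1} V + f_{p_1}^{a_1}⋯f_{p_r}^{a_r} X`. -/
noncomputable def lexFil (X : Submodule k V) : List ((I × ℕ+) × ℕ) → Submodule k V
  | [] => X
  | x :: L => LinearMap.range (S.f x.1 ^ (x.2 + 1)) ⊔ (lexFil X L).map (S.f x.1 ^ x.2)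

/-- The composite `f_{p_1}^{a_1}⋯f_{p_r}^{a_r}`. -/
noncomputable def wordMap : List ((I × ℕ+) × ℕ) → Module.End k V
  | [] => 1
  | x :: L => S.f x.1 ^ x.2 * wordMap L

/-- The word `(p_1,d_1),…,(p_r,d_r)` of the string data of `b` along `p_1,…,p_r`. -/
noncomputable def stringData (E : I × ℕ+ → V → V) : List (I × ℕ+) → V → List ((I × ℕ+) × ℕ)
  | [], _ => []
  | p :: w, b => (p, S.d p b) :: stringData E w ((E p)^[S.d p b] b)

/-- The element reached from `b` by applying `𝐞_{p_1}^{d_1}`, …, `𝐞_{p_r}^{d_r}`. -/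
noncomputable def stringEnd (E : I × ℕ+ → V → V) : List (I × ℕ+) → V → V
  | [], b => b
  | p :: w, b => stringEnd E w ((E p)^[S.d p b] b)

/-- The string data of `b` is lexicographically larger than the given word, with the
proposition `q` deciding the case of equality. -/
def LexAbove (E : I × ℕ+ → V → V) (q : Prop) : List ((I × ℕ+) × ℕ) → V → Prop
  | [], _ => q
  | x :: L, b => x.2 < S.d x.1 b ∨ (S.d x.1 b = x.2 ∧ LexAbove E q L ((E x.1)^[S.d x.1 b] b))

variable {S} {E E' : I × ℕ+ → V → V}

theorem lexAbove_stringData (q : Prop) (w : List (I × ℕ+)) (b : V) :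
    S.LexAbove E q (S.stringData E w b) b ↔ q := by
  induction w generalizing b with
  | nil => exact Iff.rfl
  | cons p w ih => simp [stringData, LexAbove, ih]

theorem stringData_eq_of_lexAbove {w : List (I × ℕ+)} {b b' : V}
    (h : S.LexAbove E' True (S.stringData E w b) b')
    (h' : S.LexAbove E True (S.stringData E' w b') b) :
    S.stringData E w b = S.stringData E' w b' := by
  induction w generalizing b b' with
  | nil => rfl
  | cons p w ih =>
    simp only [stringData, LexAbove] at h h' ⊢
    have hd : S.d p b = S.d p b' := by omega
    rw [ih (h.resolve_left (by omega)).2 (h'.resolve_left (by omega)).2, hd]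

theorem stringData_append (w w' : List (I × ℕ+)) (b : V) :
    S.stringData E (w ++ w') b =
      S.stringData E w b ++ S.stringData E w' (S.stringEnd E w b) := by
  induction w generalizing b with
  | nil => rfl
  | cons p w ih => simp [stringData, stringEnd, ih]

theorem stringEnd_append (w w' : List (I × ℕ+)) (b : V) :
    S.stringEnd E (w ++ w') b = S.stringEnd E w' (S.stringEnd E w b) := by
  induction w generalizing b with
  | nil => rfl
  | cons p w ih => simp [stringEnd, ih]

theorem stringEnd_of_d_eq_zero {h : V} (hh : ∀ p, S.d p h = 0) (w : List (I × ℕ+)) :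
    S.stringEnd E w h = h := by
  induction w with
  | nil => rfl
  | cons p w ih => simpa [stringEnd, hh] using ih

theorem stringData_of_d_eq_zero {h : V} (hh : ∀ p, S.d p h = 0) (w : List (I × ℕ+)) :
    S.stringData E w h = w.map fun p => (p, 0) := by
  induction w with
  | nil => rfl
  | cons p w ih => simpa [stringData, hh] using ih

theorem lexFil_append (X : Submodule k V) (L L' : List ((I × ℕ+) × ℕ)) :
    S.lexFil X (L ++ L') = S.lexFil (S.lexFil X L') L := by
  induction L with
  | nil => rfl
  | cons x L ih => simp [lexFil, ih]

theorem lexFil_mono {X Y : Submodule k V} (h : X ≤ Y) (L : List ((I × ℕ+) × ℕ)) :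
    S.lexFil X L ≤ S.lexFil Y L := by
  induction L with
  | nil => exact h
  | cons x L ih => exact sup_le_sup_left (Submodule.map_mono ih) _

theorem wordMap_mem_lexFil {X : Submodule k V} {v : V} (h : v ∈ X)
    (L : List ((I × ℕ+) × ℕ)) : S.wordMap L v ∈ S.lexFil X L := by
  induction L with
  | nil => exact h
  | cons x L ih => exact Submodule.mem_sup_right (Submodule.mem_map_of_mem ih)

theorem range_le_lexFil_zero (X : Submodule k V) {T : List (I × ℕ+)} {p : I × ℕ+} (hp : p ∈ T) :
    LinearMap.range (S.f p) ≤ S.lexFil X (T.map fun p => (p, 0)) := by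
  induction T with
  | nil => simp at hp
  | cons t T ih =>
    rw [List.map_cons, lexFil]
    rcases List.mem_cons.1 hp with rfl | hp
    · simp
    · refine (ih hp).trans (le_trans ?_ le_sup_right)
      simp [Module.End.one_eq_id]

theorem exists_word_of_mem_rad {v : V} (hv : v ∈ S.rad) :
    ∃ T : List (I × ℕ+), v ∈ S.lexFil ⊥ (T.map fun p => (p, 0)) := by
  classical
  obtain ⟨s, hs⟩ := Submodule.mem_iSup_iff_exists_finset.1 hv
  refine ⟨s.toList, ?_⟩
  refine (iSup₂_le fun p hp => ?_ : (⨆ p ∈ s, LinearMap.range (S.f p)) ≤ _) hs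
  exact range_le_lexFil_zero ⊥ (Finset.mem_toList.2 hp)

end WeakLowerPerfectSpace

namespace LowerPerfectBasis.IsRaising

variable {k I P V : Type*} [Field k] [AddCommGroup P] [AddCommGroup V] [Module k V]
  {S : WeakLowerPerfectSpace k I P V} {B : Set V} {LB : LowerPerfectBasis S B}
  {E : I × ℕ+ → V → V} (hE : LB.IsRaising E)
include hE

open WeakLowerPerfectSpace

theorem stringEnd_mem (w : List (I × ℕ+)) {b : V} (hb : b ∈ B) : S.stringEnd E w b ∈ B := by
  induction w generalizing b with
  | nil => exact hb
  | cons p w ih => exact ih (hE.iterate_E hb rfl).1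

/-- The lexicographic filtration is compatible with a lower perfect basis. -/
theorem lexFil_eq_span {X : Submodule k V} {q : Prop}
    (hX : X = Submodule.span k {b | b ∈ B ∧ q}) (L : List ((I × ℕ+) × ℕ)) :
    S.lexFil X L = Submodule.span k {b | b ∈ B ∧ S.LexAbove E q L b} := by
  induction L with
  | nil => exact hX
  | cons x L ih =>
    obtain ⟨p, a⟩ := x
    have hr : LinearMap.range (S.f p ^ (a + 1)) ≤
        Submodule.span k {b | b ∈ B ∧ S.LexAbove E q ((p, a) :: L) b} := by
      rw [LB.range_pow_eq_span]
      exact Submodule.span_mono fun b hb => ⟨hb.1, Or.inl hb.2⟩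
    apply le_antisymm
    · refine sup_le hr ?_
      rw [ih, Submodule.map_span, Submodule.span_le]
      rintro _ ⟨b, ⟨hb, hab⟩, rfl⟩
      by_cases h0 : S.d p b = 0
      · obtain ⟨c, -, hc⟩ := hE.f_pow_approx hb h0 a
        refine (Submodule.sub_mem_iff_left _ (Submodule.smul_mem _ c ?_)).1 (hr hc)
        rcases LB.iterate_F_mem p hb a with h | h
        · obtain ⟨h1, h2⟩ := hE.iterate_F hb h0 h
          refine Submodule.subset_span ⟨h, Or.inr ⟨h1, ?_⟩⟩
          simpa [h1, h2] using hab
        · rw [h]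
          exact zero_mem _
      · exact hr (S.f_pow_mem_range p ((LB.mem_range_pow_iff p hb 1).2 (by omega)))
    · rw [Submodule.span_le]
      rintro b ⟨hb, h | ⟨h1, h2⟩⟩
      · exact Submodule.mem_sup_left ((LB.mem_range_pow_iff p hb _).2 h)
      · obtain ⟨c, -, hc⟩ := hE.approx (p := p) hb
        simp only at h1 h2
        rw [h1] at hc h2
        refine (Submodule.sub_mem_iff_left _ (Submodule.smul_mem _ c ?_)).1
          (Submodule.mem_sup_left hc)
        refine Submodule.mem_sup_right (Submodule.mem_map_of_mem ?_)
        rw [ih]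
        refine Submodule.subset_span ⟨?_, h2⟩
        rw [← h1]
        exact (hE.iterate_E hb rfl).1

theorem lexFil_top (L : List ((I × ℕ+) × ℕ)) :
    S.lexFil ⊤ L = Submodule.span k {b | b ∈ B ∧ S.LexAbove E True L b} :=
  hE.lexFil_eq_span (by simp [LB.spans]) L

theorem lexFil_bot (L : List ((I × ℕ+) × ℕ)) :
    S.lexFil ⊥ L = Submodule.span k {b | b ∈ B ∧ S.LexAbove E False L b} :=
  hE.lexFil_eq_span (by simp) L

theorem notMem_lexFil_bot (w : List (I × ℕ+)) {b : V} (hb : b ∈ B) :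
    b ∉ S.lexFil ⊥ (S.stringData E w b) := by
  rw [hE.lexFil_bot]
  intro h
  exact (lexAbove_stringData False w b).1 (LB.mem_of_mem_span (fun b hb => hb.1) hb h).2

/-- Modulo higher terms, `b` is a multiple of `f_{p_1}^{d_1}⋯f_{p_r}^{d_r}` applied to the end
of its string. -/
theorem sub_smul_wordMap_mem (w : List (I × ℕ+)) {b : V} (hb : b ∈ B) :
    ∃ c : k, c ≠ 0 ∧ b - c • S.wordMap (S.stringData E w b) (S.stringEnd E w b) ∈
      S.lexFil ⊥ (S.stringData E w b) := by
  induction w generalizing b with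
  | nil => exact ⟨1, one_ne_zero, by simp [wordMap, stringEnd, stringData, lexFil]⟩
  | cons p w ih =>
    obtain ⟨c, hc, h⟩ := hE.approx (p := p) hb
    obtain ⟨c', hc', h'⟩ := ih (hE.iterate_E (p := p) hb rfl).1
    refine ⟨c * c', mul_ne_zero hc hc', ?_⟩
    have h1 := Submodule.smul_mem _ c (Submodule.mem_map_of_mem (f := S.f p ^ S.d p b) h')
    rw [map_sub, map_smul, smul_sub, smul_smul] at h1
    have h2 := Submodule.add_mem_sup h h1
    rwa [sub_add_sub_cancel] at h2

theorem wordMap_mem_or (L : List ((I × ℕ+) × ℕ)) {h : V} (hh : h ∈ B) :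
    S.wordMap L h ∈ S.lexFil ⊥ L ∨ ∃ b ∈ B, S.stringData E (L.map Prod.fst) b = L ∧
      S.stringEnd E (L.map Prod.fst) b = h ∧
      ∃ c : k, c ≠ 0 ∧ S.wordMap L h - c • b ∈ S.lexFil ⊥ L := by
  induction L with
  | nil => exact Or.inr ⟨h, hh, rfl, rfl, 1, one_ne_zero, by simp [wordMap]⟩
  | cons x L ih =>
    obtain ⟨p, a⟩ := x
    have hr : LinearMap.range (S.f p ^ (a + 1)) ≤ S.lexFil ⊥ ((p, a) :: L) := le_sup_left
    have hm : ∀ v ∈ S.lexFil ⊥ L, (S.f p ^ a) v ∈ S.lexFil ⊥ ((p, a) :: L) := fun v hv =>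
      Submodule.mem_sup_right (Submodule.mem_map_of_mem hv)
    rcases ih with ih | ⟨b, hb, h1, h2, c, hc, h3⟩
    · exact Or.inl (hm _ ih)
    · have h4 := hm _ h3
      rw [map_sub, map_smul] at h4
      change (S.f p ^ a) (S.wordMap L h) ∈ _ ∨ _
      by_cases h0 : S.d p b = 0
      · obtain ⟨c', hc', h5⟩ := hE.f_pow_approx hb h0 a
        have h6 := add_mem h4 (Submodule.smul_mem _ c (hr h5))
        rw [smul_sub, sub_add_sub_cancel, smul_smul] at h6
        rcases LB.iterate_F_mem p hb a with h7 | h7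
        · obtain ⟨h8, h9⟩ := hE.iterate_F hb h0 h7
          refine Or.inr ⟨_, h7, ?_, ?_, _, mul_ne_zero hc hc', h6⟩
          · simp [stringData, h8, h9, h1]
          · simp [stringEnd, h8, h9, h2]
        · rw [h7, smul_zero, sub_zero] at h6
          exact Or.inl h6
      · left
        refine (Submodule.sub_mem_iff_left _ (Submodule.smul_mem _ c (hr ?_))).1 h4
        exact S.f_pow_mem_range p ((LB.mem_range_pow_iff p hb 1).2 (by omega))

end LowerPerfectBasis.IsRaising

namespace LowerPerfectBasis.IsRaising

variable {k I P V : Type*} [Field k] [AddCommGroup P] [AddCommGroup V] [Module k V]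
  {S : WeakLowerPerfectSpace k I P V} {B : Set V} {LB : LowerPerfectBasis S B}
  {E : I × ℕ+ → V → V} (hE : LB.IsRaising E)
include hE

open WeakLowerPerfectSpace

theorem F_weight {p : I × ℕ+} {b : V} (hb : b ∈ B) (hF : LB.F p b ∈ B) {μ : P}
    (hμ : b ∈ S.weight μ) : LB.F p b ∈ S.weight (μ - (p.2 : ℕ) • S.alpha p.1) := by
  obtain ⟨π, h1, h2⟩ := S.exists_proj
  obtain ⟨ν, hν⟩ := LB.graded _ hF
  by_cases h : ν = μ - (p.2 : ℕ) • S.alpha p.1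
  · rwa [h] at hν
  · exfalso
    obtain ⟨c, hc⟩ := LB.F_approx p b hb
    have hf : S.f p b ∈ S.weight (μ - (p.2 : ℕ) • S.alpha p.1) := by
      simpa using S.f_pow_weight p 1 hμ
    rw [LB.range_pow_eq_span] at hc
    have h3 := LB.proj_mem_span h1 h2 (fun b hb => hb.1) ν hc
    rw [← LB.range_pow_eq_span, map_sub, map_smul, h2 ν _ h _ hf, h1 ν _ hν, zero_sub,
      neg_mem_iff, Submodule.smul_mem_iff _ c.ne_zero, LB.mem_range_pow_iff p hF,
      hE.d_F hb hF] at h3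
    omega

theorem exists_height : ∃ ht : V → ℕ, ∀ p, ∀ b ∈ B, S.d p b ≠ 0 →
    ht ((E p)^[S.d p b] b) < ht b := by
  classical
  obtain ⟨ht, hht⟩ := S.exists_height
  obtain ⟨π, h1, h2⟩ := S.exists_proj
  have huniq : ∀ {v : V} {μ ν : P}, v ≠ 0 → v ∈ S.weight μ → v ∈ S.weight ν → μ = ν := by
    intro v μ ν h0 hμ hν
    by_contra h
    exact h0 (by rw [← h1 μ v hμ, h2 μ ν h v hν])
  let g : V → ℕ := fun b => if h : ∃ μ, b ∈ S.weight μ then ht h.choose else 0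
  have hg : ∀ b ∈ B, ∀ μ, b ∈ S.weight μ → g b = ht μ := by
    intro b hb μ hμ
    have h : ∃ μ, b ∈ S.weight μ := ⟨μ, hμ⟩
    simp only [g, dif_pos h]
    rw [huniq (LB.ne_zero hb) h.choose_spec hμ]
  have hlt : ∀ p, ∀ b ∈ B, S.d p b ≠ 0 → g (E p b) < g b := by
    intro p b hb hd
    obtain ⟨h3, h4, -⟩ := hE.E_mem hb hd
    obtain ⟨μ, hμ⟩ := LB.graded _ h3
    have h5 := hE.F_weight h3 (h4.symm ▸ hb) hμ
    rw [h4] at h5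
    rw [hg _ h3 μ hμ, hg b hb _ h5]
    exact hht p μ fun h => LB.ne_zero h3 ((Submodule.mem_bot k).1 (h ▸ hμ))
  have hle : ∀ p, ∀ n, ∀ b ∈ B, S.d p b = n → g ((E p)^[n] b) + n ≤ g b := by
    intro p n
    induction n with
    | zero => exact fun b _ _ => le_rfl
    | succ n ih =>
      intro b hb hd
      obtain ⟨h3, -, h4⟩ := hE.E_mem hb (by omega : S.d p b ≠ 0)
      have h5 := ih (E p b) h3 (by omega)
      have h6 := hlt p b hb (by omega)
      rw [Function.iterate_succ_apply]
      omega
  refine ⟨g, fun p b hb hd => ?_⟩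
  have := hle p _ b hb rfl
  omega

theorem exists_stringEnd_mem {b : V} (hb : b ∈ B) :
    ∃ w, S.stringEnd E w b ∈ S.highestCore B := by
  obtain ⟨g, hg⟩ := hE.exists_height
  induction hn : g b using Nat.strong_induction_on generalizing b with
  | _ n ih =>
    by_cases h : ∀ p, S.d p b = 0
    · exact ⟨[], hb, h⟩
    · push Not at h
      obtain ⟨p, hp⟩ := h
      obtain ⟨w, hw⟩ := ih _ (hn ▸ hg p b hb hp) (hE.iterate_E hb rfl).1 rfl
      exact ⟨p :: w, hw⟩

theorem bseq_mem {b : V} (hb : b ∈ B) (seq : ℕ → I × ℕ+) (m : ℕ) : bseq E S.d seq b m ∈ B := by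
  induction m with
  | zero => exact hb
  | succ m ih => exact (hE.iterate_E ih rfl).1

theorem bseq_eventually_mem {b : V} (hb : b ∈ B) {seq : ℕ → I × ℕ+}
    (hseq : ∀ p : I × ℕ+, ∀ N : ℕ, ∃ m ≥ N, seq m = p) :
    ∃ N : ℕ, ∀ m ≥ N, bseq E S.d seq b m ∈ S.highestCore B := by
  obtain ⟨g, hg⟩ := hE.exists_height
  obtain ⟨N, hN⟩ : ∃ N, ∀ m, g (bseq E S.d seq b N) ≤ g (bseq E S.d seq b m) := by
    obtain ⟨N, hN⟩ := exists_minimalFor_of_wellFoundedLT (fun _ : ℕ => True)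
      (fun m => g (bseq E S.d seq b m)) ⟨0, trivial⟩
    exact ⟨N, fun m => (le_total _ _).elim id fun h => hN.2 trivial h⟩
  have hd : ∀ m, bseq E S.d seq b (N + m) = bseq E S.d seq b N →
      S.d (seq (N + m)) (bseq E S.d seq b N) = 0 := by
    intro m hm
    by_contra h
    have h1 := hg _ _ (hE.bseq_mem hb seq N) h
    have h2 := hN (N + m + 1)
    rw [bseq, hm] at h2
    omega
  have hstep : ∀ m, bseq E S.d seq b (N + m) = bseq E S.d seq b N := by
    intro m
    induction m with
    | zero => rfl
    | succ m ih =>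
      rw [← add_assoc, bseq, ih, hd m ih]
      rfl
  refine ⟨N, fun m hm => ⟨hE.bseq_mem hb seq m, fun p => ?_⟩⟩
  obtain ⟨m', hm', rfl⟩ := hseq p N
  obtain ⟨j, rfl⟩ := Nat.exists_eq_add_of_le hm
  obtain ⟨j', rfl⟩ := Nat.exists_eq_add_of_le hm'
  rw [hstep j]
  exact hd j' (hstep j')

end LowerPerfectBasis.IsRaising

section Comparison

open WeakLowerPerfectSpace

variable {k I P V : Type*} [Field k] [AddCommGroup P] [AddCommGroup V] [Module k V]
  {S : WeakLowerPerfectSpace k I P V} {B B' : Set V} {LB : LowerPerfectBasis S B}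
  {LB' : LowerPerfectBasis S B'} {E E' : I × ℕ+ → V → V}

/-- `b` and `b'` have the same string data along `w`, ending in the same class of `V_H`. -/
def StringEquiv (S : WeakLowerPerfectSpace k I P V) (B B' : Set V) (E E' : I × ℕ+ → V → V)
    (w : List (I × ℕ+)) (b b' : V) : Prop :=
  S.stringData E w b = S.stringData E' w b' ∧ S.stringEnd E w b ∈ S.highestCore B ∧
    S.stringEnd E' w b' ∈ S.highestCore B' ∧
    S.rad.mkQ (S.stringEnd E w b) = S.rad.mkQ (S.stringEnd E' w b')

/-- `b` and `b'` have the same string data along `w` and are proportional modulo higher terms. -/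
def StringCongr (S : WeakLowerPerfectSpace k I P V) (E E' : I × ℕ+ → V → V)
    (w : List (I × ℕ+)) (b b' : V) : Prop :=
  S.stringData E w b = S.stringData E' w b' ∧
    ∃ c : k, c ≠ 0 ∧ b - c • b' ∈ S.lexFil ⊥ (S.stringData E w b)

theorem StringEquiv.symm {w : List (I × ℕ+)} {b b' : V} (h : StringEquiv S B B' E E' w b b') :
    StringEquiv S B' B E' E w b' b :=
  ⟨h.1.symm, h.2.2.1, h.2.1, h.2.2.2.symm⟩

theorem StringCongr.symm {w : List (I × ℕ+)} {b b' : V} (h : StringCongr S E E' w b b') :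
    StringCongr S E' E w b' b := by
  obtain ⟨h1, c, hc, h2⟩ := h
  refine ⟨h1.symm, c⁻¹, inv_ne_zero hc, ?_⟩
  have := Submodule.smul_mem _ (-c⁻¹) h2
  rw [← h1]
  rwa [smul_sub, smul_smul, neg_mul, inv_mul_cancel₀ hc, neg_smul, neg_smul, one_smul,
    sub_neg_eq_add, neg_add_eq_sub] at this

theorem StringCongr.mem_of_sub_mem {w : List (I × ℕ+)} {b b' : V}
    (hE' : LB'.IsRaising E') (hb' : b' ∈ B') (h : StringCongr S E E' w b b')
    {X : Set V} (hX : X ⊆ B') (hbX : b ∈ Submodule.span k X) : b' ∈ X := by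
  obtain ⟨h1, c, hc, h2⟩ := h
  rw [hE'.lexFil_bot] at h2
  have h3 : c • b' ∈ Submodule.span k
      (X ∪ {x | x ∈ B' ∧ S.LexAbove E' False (S.stringData E w b) x}) := by
    rw [← sub_sub_cancel b (c • b')]
    exact sub_mem (Submodule.span_mono Set.subset_union_left hbX)
      (Submodule.span_mono Set.subset_union_right h2)
  rw [Submodule.smul_mem_iff _ hc] at h3
  rcases LB'.mem_of_mem_span (Set.union_subset hX fun x hx => hx.1) hb' h3 with h4 | h4
  · exact h4
  · rw [h1] at h4
    exact ((lexAbove_stringData False w b').1 h4.2).elim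

theorem StringCongr.lexAbove {w : List (I × ℕ+)} {b b' : V} (hE : LB.IsRaising E)
    (hE' : LB'.IsRaising E') (hb : b ∈ B) (hb' : b' ∈ B') (h : StringCongr S E E' w b b')
    (w' : List (I × ℕ+)) : S.LexAbove E' True (S.stringData E w' b) b' := by
  refine (h.mem_of_sub_mem hE' hb' (X := {x | x ∈ B' ∧ S.LexAbove E' True (S.stringData E w' b) x})
    (fun x hx => hx.1) ?_).2
  rw [← hE'.lexFil_top, hE.lexFil_top]
  exact Submodule.subset_span ⟨hb, (lexAbove_stringData True w' b).2 trivial⟩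

/-- Proportionality modulo higher terms along one word forces equal string data along all words. -/
theorem StringCongr.stringData_eq {w : List (I × ℕ+)} {b b' : V} (hE : LB.IsRaising E)
    (hE' : LB'.IsRaising E') (hb : b ∈ B) (hb' : b' ∈ B') (h : StringCongr S E E' w b b')
    (w' : List (I × ℕ+)) : S.stringData E w' b = S.stringData E' w' b' :=
  stringData_eq_of_lexAbove (h.lexAbove hE hE' hb hb' w') (h.symm.lexAbove hE' hE hb' hb w')

theorem StringCongr.unique {w w' : List (I × ℕ+)} {b b' b'' : V} (hE : LB.IsRaising E)
    (hE' : LB'.IsRaising E') (hb : b ∈ B) (hb' : b' ∈ B') (hb'' : b'' ∈ B')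
    (h : StringCongr S E E' w b b') (h' : StringCongr S E E' w' b b'') : b' = b'' := by
  obtain ⟨h1, c, -, h2⟩ := h'
  rw [hE'.lexFil_bot] at h2
  have h3 := h.mem_of_sub_mem hE' hb'
    (X := {b''} ∪ {x | x ∈ B' ∧ S.LexAbove E' False (S.stringData E w' b) x})
    (Set.union_subset (Set.singleton_subset_iff.2 hb'') fun x hx => hx.1) (by
      have h3 := add_mem (Submodule.span_mono Set.subset_union_right h2) (Submodule.smul_mem _ c
        (Submodule.subset_span (Set.mem_union_left _ (Set.mem_singleton b''))))
      rwa [sub_add_cancel] at h3)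
  rcases h3 with h3 | h3
  · exact h3
  · have h4 := h3.2
    rw [h.stringData_eq hE hE' hb hb' w', lexAbove_stringData] at h4
    exact h4.elim

theorem StringCongr.mem_weight {w : List (I × ℕ+)} {b b' : V}
    (hE' : LB'.IsRaising E') (hb' : b' ∈ B') (h : StringCongr S E E' w b b')
    {μ : P} (hμ : b ∈ S.weight μ) : b' ∈ S.weight μ := by
  obtain ⟨π, h1, h2⟩ := S.exists_proj
  obtain ⟨ν, hν⟩ := LB'.graded _ hb'
  by_cases hne : ν = μ
  · rwa [hne] at hν
  · obtain ⟨h3, c, hc, h4⟩ := h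
    rw [hE'.lexFil_bot] at h4
    have h5 := LB'.proj_mem_span h1 h2 (fun x hx => hx.1) ν h4
    rw [← hE'.lexFil_bot, map_sub, map_smul, h2 ν μ hne b hμ, h1 ν b' hν, zero_sub, neg_mem_iff,
      Submodule.smul_mem_iff _ hc, h3] at h5
    exact (hE'.notMem_lexFil_bot w hb' h5).elim

theorem StringEquiv.exists_congr {w : List (I × ℕ+)} {b b' : V} (hE : LB.IsRaising E)
    (hE' : LB'.IsRaising E') (hb : b ∈ B) (hb' : b' ∈ B')
    (h : StringEquiv S B B' E E' w b b') : ∃ w', StringCongr S E E' w' b b' := by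
  obtain ⟨h1, h2, h3, h4⟩ := h
  have h4 : S.stringEnd E w b - S.stringEnd E' w b' ∈ S.rad := (Submodule.Quotient.eq _).1 h4
  obtain ⟨T, hT⟩ := exists_word_of_mem_rad h4
  have e1 : S.stringData E (w ++ T) b = S.stringData E w b ++ T.map (fun p => (p, 0)) := by
    rw [stringData_append, stringData_of_d_eq_zero h2.2]
  have e2 : S.stringData E' (w ++ T) b' = S.stringData E w b ++ T.map (fun p => (p, 0)) := by
    rw [stringData_append, stringData_of_d_eq_zero h3.2, h1]
  refine ⟨w ++ T, e1.trans e2.symm, ?_⟩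
  obtain ⟨c, hc, h5⟩ := hE.sub_smul_wordMap_mem w hb
  obtain ⟨c', hc', h6⟩ := hE'.sub_smul_wordMap_mem w hb'
  have h7 := wordMap_mem_lexFil (S := S) hT (S.stringData E w b)
  rw [← h1] at h6
  rw [e1, lexFil_append]
  have hle := lexFil_mono (S := S) (bot_le : ⊥ ≤ S.lexFil ⊥ (T.map fun p => (p, 0)))
    (S.stringData E w b)
  refine ⟨c * c'⁻¹, mul_ne_zero hc (inv_ne_zero hc'), ?_⟩
  have h8 := sub_mem (add_mem (hle h5) (Submodule.smul_mem _ c h7))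
    (Submodule.smul_mem _ (c * c'⁻¹) (hle h6))
  convert h8 using 1
  rw [map_sub, smul_sub, smul_sub, smul_smul, mul_assoc, inv_mul_cancel₀ hc', mul_one]
  abel

theorem exists_stringEquiv (hE : LB.IsRaising E) (hE' : LB'.IsRaising E')
    (hcore : ⇑S.rad.mkQ '' S.highestCore B ⊆ ⇑S.rad.mkQ '' S.highestCore B')
    {w : List (I × ℕ+)} {b : V} (hb : b ∈ B) (hw : S.stringEnd E w b ∈ S.highestCore B) :
    ∃ b' ∈ B', ∃ T, StringEquiv S B B' E E' (w ++ T) b b' := by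
  obtain ⟨h', hh', heq⟩ := hcore ⟨_, hw, rfl⟩
  have h4 : S.stringEnd E w b - h' ∈ S.rad := (Submodule.Quotient.eq _).1 heq.symm
  obtain ⟨T, hT⟩ := exists_word_of_mem_rad h4
  have e1 : S.stringData E (w ++ T) b = S.stringData E w b ++ T.map (fun p => (p, 0)) := by
    rw [stringData_append, stringData_of_d_eq_zero hw.2]
  have e3 : S.stringEnd E (w ++ T) b = S.stringEnd E w b := by
    rw [stringEnd_append, stringEnd_of_d_eq_zero hw.2]
  obtain ⟨c, hc, h5⟩ := hE.sub_smul_wordMap_mem (w ++ T) hb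
  have h6 := wordMap_mem_lexFil (S := S) hT (S.stringData E w b)
  rw [← lexFil_append, ← e1] at h6
  have e4 : S.wordMap (S.stringData E w b) = S.wordMap (S.stringData E (w ++ T) b) := by
    rw [e1]
    induction S.stringData E w b with
    | nil =>
      clear hT h5 h6 e1 e3
      induction T with
      | nil => rfl
      | cons t T ih => simpa [wordMap] using ih
    | cons x L ih => simp [wordMap, ih]
  rw [e4, map_sub] at h6
  rw [e3] at h5
  have hfst : (S.stringData E (w ++ T) b).map Prod.fst = w ++ T := by
    generalize w ++ T = u
    clear * -
    induction u generalizing b with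
    | nil => rfl
    | cons p u ih => simp [stringData, ih]
  rcases hE'.wordMap_mem_or (S.stringData E (w ++ T) b) hh'.1 with h7 | ⟨b', hb', h8, h9, -⟩
  · have h8 := add_mem h6 h7
    rw [sub_add_cancel] at h8
    exact (hE.notMem_lexFil_bot _ hb
      ((Submodule.sub_mem_iff_left _ (Submodule.smul_mem _ c h8)).1 h5)).elim
  · rw [hfst] at h8 h9
    refine ⟨b', hb', T, h8.symm, ?_, ?_, ?_⟩
    · rw [e3]; exact hw
    · rw [h9]; exact hh'
    · rw [e3, h9, heq]

theorem StringEquiv.raise {p : I × ℕ+} {u : List (I × ℕ+)} {b b' : V} (hE : LB.IsRaising E)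
    (hE' : LB'.IsRaising E') (hb : b ∈ B) (hb' : b' ∈ B') (hd : S.d p b ≠ 0)
    (h : StringEquiv S B B' E E' (p :: u) b b') :
    StringEquiv S B B' E E' (p :: u) (E p b) (E' p b') := by
  obtain ⟨h1, h2⟩ := h
  simp only [stringData, stringEnd, List.cons.injEq, Prod.mk.injEq, true_and] at h1 h2
  obtain ⟨n, hn⟩ := Nat.exists_eq_succ_of_ne_zero hd
  have h3 := (hE.E_mem hb hd).2.2
  have h4 := (hE'.E_mem hb' (h1.1 ▸ hd)).2.2
  have h5 : S.d p (E p b) = n := by omega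
  have h6 : S.d p (E' p b') = n := by omega
  have h7 : S.d p b' = n + 1 := by omega
  rw [hn, h7] at h1 h2
  simp only [Nat.succ_eq_add_one, Function.iterate_succ_apply] at h1 h2
  refine ⟨?_, ?_⟩
  · simp only [stringData, h5, h6, h1.2]
  · simpa only [stringEnd, h5, h6] using h2

end Comparison

theorem stmt_14 {k I P V : Type*} [Field k] [AddCommGroup P] [AddCommGroup V] [Module k V]
    (S : WeakLowerPerfectSpace k I P V) (B B' : Set V)
    (LB : LowerPerfectBasis S B) (LB' : LowerPerfectBasis S B')
    (E E' : I × ℕ+ → V → V)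
    (hE0 : ∀ il : I × ℕ+, E il 0 = 0)
    (hEdef : ∀ il : I × ℕ+, ∀ b ∈ B, ∀ b' ∈ B, LB.F il b' = b → E il b = b')
    (hEnone : ∀ il : I × ℕ+, ∀ b ∈ B, (∀ b' ∈ B, LB.F il b' ≠ b) → E il b = 0)
    (hE0' : ∀ il : I × ℕ+, E' il 0 = 0)
    (hEdef' : ∀ il : I × ℕ+, ∀ b ∈ B', ∀ b' ∈ B', LB'.F il b' = b → E' il b = b')
    (hEnone' : ∀ il : I × ℕ+, ∀ b ∈ B', (∀ b' ∈ B', LB'.F il b' ≠ b) → E' il b = 0)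
    (hcore : ⇑S.rad.mkQ '' S.highestCore B = ⇑S.rad.mkQ '' S.highestCore B') :
    ∃ ψ : V → V, ψ 0 = 0 ∧ Set.BijOn ψ B B' ∧
      (∀ μ : P, ψ '' (B ∩ (S.weight μ : Set V)) = B' ∩ (S.weight μ : Set V)) ∧
      (∀ b ∈ B, ∀ il : I × ℕ+, S.d il (ψ b) = S.d il b) ∧
      (∀ b ∈ B, ∀ il : I × ℕ+, ψ (LB.F il b) = LB'.F il (ψ b)) ∧
      (∀ b ∈ B, ∀ il : I × ℕ+, ψ (E il b) = E' il (ψ b)) ∧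
      (∀ b ∈ S.highestCore B, S.rad.mkQ (ψ b) = S.rad.mkQ b) ∧
      (∀ b ∈ B, ∀ seq : ℕ → I × ℕ+, (∀ p : I × ℕ+, ∀ N : ℕ, ∃ m ≥ N, seq m = p) →
        (∀ m : ℕ, S.d (seq m) (bseq E S.d seq b m) = S.d (seq m) (bseq E' S.d seq (ψ b) m)) ∧
        ∃ N : ℕ, ∀ m ≥ N, bseq E S.d seq b m ∈ S.highestCore B ∧
          bseq E' S.d seq (ψ b) m ∈ S.highestCore B' ∧
          S.rad.mkQ (bseq E S.d seq b m) = S.rad.mkQ (bseq E' S.d seq (ψ b) m) ∧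
          S.rad.mkQ (bseq E S.d seq b m) ∈ ⇑S.rad.mkQ '' S.highestCore B) := by
  have hE : LB.IsRaising E := ⟨hEdef, hEnone⟩
  have hE' : LB'.IsRaising E' := ⟨hEdef', hEnone'⟩
  have hex : ∀ b ∈ B, ∃ b' ∈ B', ∃ w, StringEquiv S B B' E E' w b b' := by
    intro b hb
    obtain ⟨w, hw⟩ := hE.exists_stringEnd_mem hb
    obtain ⟨b', hb', T, h⟩ := exists_stringEquiv hE hE' hcore.subset hb hw
    exact ⟨b', hb', _, h⟩
  have hex' : ∀ b' ∈ B', ∃ b ∈ B, ∃ w, StringEquiv S B B' E E' w b b' := by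
    intro b' hb'
    obtain ⟨w, hw⟩ := hE'.exists_stringEnd_mem hb'
    obtain ⟨b, hb, T, h⟩ := exists_stringEquiv hE' hE hcore.superset hb' hw
    exact ⟨b, hb, _, h.symm⟩
  have hun : ∀ b ∈ B, ∀ b₁ ∈ B', ∀ b₂ ∈ B', ∀ w₁ w₂, StringEquiv S B B' E E' w₁ b b₁ →
      StringEquiv S B B' E E' w₂ b b₂ → b₁ = b₂ := by
    intro b hb b₁ hb₁ b₂ hb₂ w₁ w₂ h₁ h₂
    obtain ⟨u₁, c₁⟩ := h₁.exists_congr hE hE' hb hb₁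
    obtain ⟨u₂, c₂⟩ := h₂.exists_congr hE hE' hb hb₂
    exact c₁.unique hE hE' hb hb₁ hb₂ c₂
  have hun' : ∀ b' ∈ B', ∀ b₁ ∈ B, ∀ b₂ ∈ B, ∀ w₁ w₂, StringEquiv S B B' E E' w₁ b₁ b' →
      StringEquiv S B B' E E' w₂ b₂ b' → b₁ = b₂ := by
    intro b' hb' b₁ hb₁ b₂ hb₂ w₁ w₂ h₁ h₂
    obtain ⟨u₁, c₁⟩ := h₁.exists_congr hE hE' hb₁ hb'
    obtain ⟨u₂, c₂⟩ := h₂.exists_congr hE hE' hb₂ hb'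
    exact c₁.symm.unique hE' hE hb' hb₁ hb₂ c₂.symm
  choose! ψ₀ hψB hψ using hex
  classical
  let ψ : V → V := fun v => if v ∈ B then ψ₀ v else 0
  have hψ0 : ψ 0 = 0 := if_neg LB.zero_notMem
  have hψm : ∀ b ∈ B, ψ b ∈ B' := fun b hb => by simpa [ψ, hb] using hψB b hb
  have hψe : ∀ b ∈ B, ∃ w, StringEquiv S B B' E E' w b (ψ b) := fun b hb => by
    simpa [ψ, hb] using hψ b hb
  have hψc : ∀ b ∈ B, ∃ w, StringCongr S E E' w b (ψ b) := fun b hb => by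
    obtain ⟨w, h⟩ := hψe b hb
    exact h.exists_congr hE hE' hb (hψm b hb)
  have heq : ∀ b ∈ B, ∀ b' ∈ B', ∀ w, StringEquiv S B B' E E' w b b' → ψ b = b' := by
    intro b hb b' hb' w h
    obtain ⟨w', h'⟩ := hψe b hb
    exact hun b hb _ (hψm b hb) _ hb' w' w h' h
  have hsurj : ∀ b' ∈ B', ∃ b ∈ B, ψ b = b' := by
    intro b' hb'
    obtain ⟨b, hb, w, h⟩ := hex' b' hb'
    exact ⟨b, hb, heq b hb b' hb' w h⟩
  have hd : ∀ b ∈ B, ∀ il : I × ℕ+, S.d il (ψ b) = S.d il b := by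
    intro b hb p
    obtain ⟨w, h⟩ := hψc b hb
    have := h.stringData_eq hE hE' hb (hψm b hb) [p]
    simpa [WeakLowerPerfectSpace.stringData] using this.symm
  have hψE : ∀ b ∈ B, ∀ p, ψ (E p b) = E' p (ψ b) := by
    intro b hb p
    by_cases h0 : S.d p b = 0
    · rw [hE.E_eq_zero hb h0, hψ0, hE'.E_eq_zero (hψm b hb) ((hd b hb p).trans h0)]
    · obtain ⟨v, hv⟩ := hE.exists_stringEnd_mem (hE.iterate_E (p := p) hb rfl).1
      obtain ⟨b', hb', T, h⟩ := exists_stringEquiv (w := p :: v) hE hE' hcore.subset hb hv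
      have h1 := heq b hb b' hb' _ h
      have h2 := h.raise hE hE' hb hb' h0
      rw [← h1] at h2
      refine heq _ (hE.E_mem hb h0).1 _ (hE'.E_mem (hψm b hb) ?_).1 _ h2
      rwa [hd b hb p]
  have hψF : ∀ b ∈ B, ∀ p, ψ (LB.F p b) = LB'.F p (ψ b) := by
    intro b hb p
    by_cases h1 : LB.F p b ∈ B
    · have h2 := hψE _ h1 p
      rw [hE.E_F hb h1] at h2
      rw [h2]
      refine ((hE'.E_mem (hψm _ h1) ?_).2.1).symm
      rw [hd _ h1, hE.d_F hb h1]
      exact Nat.succ_ne_zero _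
    · have h2 : LB.F p b = 0 := (LB.F_mem p b hb).resolve_left h1
      rcases LB'.F_mem p _ (hψm b hb) with h3 | h3
      · obtain ⟨b₁, hb₁, h4⟩ := hsurj _ h3
        have h5 : S.d p b₁ ≠ 0 := by
          rw [← hd b₁ hb₁, h4, hE'.d_F (hψm b hb) h3]
          exact Nat.succ_ne_zero _
        obtain ⟨h6, h7, -⟩ := hE.E_mem hb₁ h5
        have h8 := hψE b₁ hb₁ p
        rw [h4, hE'.E_F (hψm b hb) h3] at h8
        obtain ⟨w, h9⟩ := hψe b hb
        obtain ⟨w', h10⟩ := hψe _ h6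
        rw [h8] at h10
        have h11 := hun' _ (hψm b hb) _ hb _ h6 w w' h9 h10
        rw [← h11] at h7
        exact (h1 (h7.symm ▸ hb₁)).elim
      · rw [h2, hψ0]
        exact h3.symm
  have hcoreψ : ∀ b ∈ S.highestCore B, ψ b ∈ S.highestCore B' := fun b hb =>
    ⟨hψm b hb.1, fun p => (hd b hb.1 p).trans (hb.2 p)⟩
  have hpH : ∀ b ∈ S.highestCore B, S.rad.mkQ (ψ b) = S.rad.mkQ b := by
    intro b hb
    obtain ⟨w, -, -, -, h⟩ := hψe b hb.1
    rw [WeakLowerPerfectSpace.stringEnd_of_d_eq_zero hb.2,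
      WeakLowerPerfectSpace.stringEnd_of_d_eq_zero (hcoreψ b hb).2] at h
    exact h.symm
  have hiter : ∀ p, ∀ n, ∀ b ∈ B, S.d p b = n → ψ ((E p)^[n] b) = (E' p)^[n] (ψ b) := by
    intro p n
    induction n with
    | zero => exact fun b _ _ => rfl
    | succ n ih =>
      intro b hb hn
      obtain ⟨h1, -, h2⟩ := hE.E_mem hb (by omega : S.d p b ≠ 0)
      rw [Function.iterate_succ_apply, Function.iterate_succ_apply, ih _ h1 (by omega), hψE b hb]
  have hbseq : ∀ b ∈ B, ∀ seq : ℕ → I × ℕ+, ∀ m,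
      bseq E' S.d seq (ψ b) m = ψ (bseq E S.d seq b m) := by
    intro b hb seq m
    induction m with
    | zero => rfl
    | succ m ih =>
      have h := hE.bseq_mem hb seq m
      rw [bseq, bseq, ih, hd _ h, hiter _ _ _ h rfl]
  refine ⟨ψ, hψ0, ⟨hψm, ?_, hsurj⟩, ?_, hd, hψF, hψE, hpH, ?_⟩
  · intro b hb b₁ hb₁ h
    obtain ⟨w, h1⟩ := hψe b hb
    obtain ⟨w₁, h2⟩ := hψe b₁ hb₁
    exact hun' _ (hψm b hb) _ hb _ hb₁ w w₁ h1 (h.symm ▸ h2)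
  · intro μ
    ext v
    constructor
    · rintro ⟨b, ⟨hb, hμ⟩, rfl⟩
      obtain ⟨w, h⟩ := hψc b hb
      exact ⟨hψm b hb, h.mem_weight hE' (hψm b hb) hμ⟩
    · rintro ⟨hv, hμ⟩
      obtain ⟨b, hb, rfl⟩ := hsurj v hv
      obtain ⟨w, h⟩ := hψc b hb
      exact ⟨b, ⟨hb, h.symm.mem_weight hE hb hμ⟩, rfl⟩
  · intro b hb seq hseq
    refine ⟨fun m => ?_, ?_⟩
    · rw [hbseq b hb, hd _ (hE.bseq_mem hb seq m)]
    · obtain ⟨N, hN⟩ := hE.bseq_eventually_mem hb hseq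
      refine ⟨N, fun m hm => ?_⟩
      have h := hN m hm
      rw [hbseq b hb]
      exact ⟨h, hcoreψ _ h, (hpH _ h).symm, Set.mem_image_of_mem _ h⟩
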